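/- arXiv:1808.08835 — 3 statements merged into one kernel-verified Lean document; each statement's English description precedes it below -/
import Mathlib

section
/- Let (b_n)_{n≥0} and (λ_n)_{n≥0} be sequences of positive integers with b_n → ∞, λ_n → ∞, and log b_{n+1} / (∑_{k=0}^{n} λ_k log b_k) → ∞. Let ξ = [0; b₀^{λ₀}, b₁^{λ₁}, …]. Then w*_{=2}(ξ) = +∞; that is, for every w > 0 there exist real quadratic irrationals α of arbitrarily large height with 0 < |ξ − α| ≤ H(α)^{−w}. -/
open Filter Finset Polynomial

/-- Numerators of the convergents of the continued fraction `[a 0; a 1, a 2, …]`. -/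
def convP (a : ℕ → ℤ) : ℕ → ℤ
  | 0 => a 0
  | 1 => a 1 * a 0 + 1
  | (n+2) => a (n+2) * convP a (n+1) + convP a n

/-- Denominators of the convergents of the continued fraction `[a 0; a 1, a 2, …]`. -/
def convQ (a : ℕ → ℤ) : ℕ → ℤ
  | 0 => 1
  | 1 => a 1
  | (n+2) => a (n+2) * convQ a (n+1) + convQ a n

/-- `ξ` is the value of the continued fraction with partial quotients `a`,
i.e. the limit of its convergents. -/
def IsCFValue (a : ℕ → ℤ) (ξ : ℝ) : Prop :=
  Filter.Tendsto (fun n => (convP a n : ℝ) / (convQ a n : ℝ)) Filter.atTop (nhds ξ)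

/-- Naive height of an integer polynomial: max of the absolute values of its coefficients. -/
def polyHeight (P : Polynomial ℤ) : ℕ := P.support.sup fun i => (P.coeff i).natAbs

/-- Naive height of a real algebraic number: the height of its minimal polynomial over `ℤ`
(an irreducible integer polynomial vanishing at `α`). -/
noncomputable def algHeight (α : ℝ) : ℕ :=
  sInf {h | ∃ P : Polynomial ℤ, Irreducible P ∧ Polynomial.aeval α P = 0 ∧ polyHeight P = h}

/-- `α` is algebraic of degree exactly `n` over `ℚ`. -/
def IsAlgDeg (α : ℝ) (n : ℕ) : Prop :=
  ∃ P : Polynomial ℤ, Irreducible P ∧ P.natDegree = n ∧ Polynomial.aeval α P = 0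

/-- `wEq ξ n`: the supremum (in `EReal`) of the real numbers `w` such that for arbitrarily
large `H` there is an irreducible integer polynomial `P` of degree exactly `n` with
`H(P) ≤ H` and `0 < |P(ξ)| ≤ H ^ (-w)`. -/
noncomputable def wEq (ξ : ℝ) (n : ℕ) : EReal :=
  sSup {x : EReal | ∃ w : ℝ, x = (w : EReal) ∧ ∀ H₀ : ℝ, ∃ H : ℝ, H₀ ≤ H ∧
    ∃ P : Polynomial ℤ, Irreducible P ∧ P.natDegree = n ∧ (polyHeight P : ℝ) ≤ H ∧
      0 < |Polynomial.aeval ξ P| ∧ |Polynomial.aeval ξ P| ≤ H ^ (-w)}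

/-- `wEqStar ξ n`: the supremum (in `EReal`) of the real numbers `w` such that for
arbitrarily large `H` there is a real algebraic number `α` of degree exactly `n` with
`H(α) ≤ H` and `0 < |ξ - α| ≤ H(α)⁻¹ * H ^ (-w)`. -/
noncomputable def wEqStar (ξ : ℝ) (n : ℕ) : EReal :=
  sSup {x : EReal | ∃ w : ℝ, x = (w : EReal) ∧ ∀ H₀ : ℝ, ∃ H : ℝ, H₀ ≤ H ∧
    ∃ α : ℝ, IsAlgDeg α n ∧ (algHeight α : ℝ) ≤ H ∧
      0 < |ξ - α| ∧ |ξ - α| ≤ (algHeight α : ℝ)⁻¹ * H ^ (-w)}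

theorem qp_two_le_natDegree {α : ℝ} (hα : Irrational α) {Q : ℤ[X]} (hQ : Q ≠ 0)
    (h : Polynomial.aeval α Q = 0) : 2 ≤ Q.natDegree := by
  by_contra hlt
  have h1 : Q.natDegree ≤ 1 := by omega
  obtain ⟨c, d, rfl⟩ := Polynomial.exists_eq_X_add_C_of_natDegree_le_one h1
  simp at h
  by_cases hc : c = 0
  · subst hc
    simp at h
    subst h
    simp at hQ
  · apply hα
    refine ⟨-(d : ℚ) / c, ?_⟩
    have hc' : (c : ℝ) ≠ 0 := by exact_mod_cast hc
    push_cast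
    field_simp
    linarith

theorem qp_coeff_le (P : ℤ[X]) (i : ℕ) : (P.coeff i).natAbs ≤ polyHeight P := by
  by_cases hi : i ∈ P.support
  · exact Finset.le_sup (f := fun i => (P.coeff i).natAbs) hi
  · simp [Polynomial.notMem_support_iff.mp hi]

theorem qp_exists_factor {α : ℝ} {F : ℤ[X]} (hF : F ≠ 0)
    (h : Polynomial.aeval α F = 0) :
    ∃ Q : ℤ[X], Irreducible Q ∧ Polynomial.aeval α Q = 0 ∧ Q ∣ F := by
  induction F using WfDvdMonoid.induction_on_irreducible with
  | zero => exact absurd rfl hF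
  | unit u hu =>
    exfalso
    have := hu.map (Polynomial.aeval α)
    rw [h] at this
    exact not_isUnit_zero this
  | mul a i ha hi ih =>
    rw [map_mul, mul_eq_zero] at h
    rcases h with h | h
    · exact ⟨i, hi, h, dvd_mul_right _ _⟩
    · obtain ⟨Q, h1, h2, h3⟩ := ih ha h
      exact ⟨Q, h1, h2, h3.mul_left _⟩

theorem qp_natDegree_irred {α : ℝ} {P : ℤ[X]} (hP : Irreducible P) (hd : P.natDegree ≠ 0)
    (h : Polynomial.aeval α P = 0) : P.natDegree = (minpoly ℚ α).natDegree := by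
  have hprim := hP.isPrimitive hd
  have hirr := (hprim.irreducible_iff_irreducible_map_fraction_map (K := ℚ)).mp hP
  have h0 : Polynomial.aeval α (P.map (algebraMap ℤ ℚ)) = 0 := by
    rw [Polynomial.aeval_map_algebraMap]; exact h
  have := minpoly.eq_of_irreducible hirr h0
  rw [← this, Polynomial.natDegree_mul_C]
  · rw [Polynomial.natDegree_map_eq_of_injective (by exact Int.cast_injective)]
  · exact inv_ne_zero (Polynomial.leadingCoeff_ne_zero.mpr hirr.ne_zero)

theorem qp_factor_height {α : ℝ} (hα : Irrational α) (A B D : ℤ)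
    (h0 : (A : ℝ) * α ^ 2 + B * α + D = 0) (hne : ¬ (A = 0 ∧ B = 0 ∧ D = 0)) (K : ℕ)
    (hA : |A| ≤ K) (hB : |B| ≤ K) (hD : |D| ≤ K) :
    ∃ Q : ℤ[X], Irreducible Q ∧ Q.natDegree = 2 ∧ Polynomial.aeval α Q = 0 ∧
      polyHeight Q ≤ K := by
  set F : ℤ[X] := C A * X ^ 2 + C B * X + C D with hFdef
  have hFdeg : F.natDegree ≤ 2 := Polynomial.natDegree_quadratic_le
  have c2 : F.coeff 2 = A := by
    simp [hFdef, Polynomial.coeff_X, Polynomial.coeff_C, -eq_intCast]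
  have c1 : F.coeff 1 = B := by
    simp [hFdef, Polynomial.coeff_X, Polynomial.coeff_C, -eq_intCast]
  have c0 : F.coeff 0 = D := by simp [hFdef]
  have hF : F ≠ 0 := by
    intro h
    apply hne
    rw [← c2, ← c1, ← c0, h]
    simp
  have hFα : Polynomial.aeval α F = 0 := by
    simp [hFdef]; linarith
  obtain ⟨Q, hQ, hQα, R, hR⟩ := qp_exists_factor hF hFα
  have hQd := qp_two_le_natDegree hα hQ.ne_zero hQα
  have hR0 : R ≠ 0 := by
    rintro rfl
    simp at hR
    exact hF hR
  have hsum := Polynomial.natDegree_mul hQ.ne_zero hR0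
  rw [← hR] at hsum
  have hRd : R.natDegree = 0 := by omega
  obtain ⟨r, rfl⟩ := Polynomial.natDegree_eq_zero.mp hRd
  have hr : r ≠ 0 := by
    rintro rfl
    simp at hR0
  refine ⟨Q, hQ, by omega, hQα, ?_⟩
  unfold polyHeight
  refine Finset.sup_le fun i hi => ?_
  have hi2 : i ≤ 2 := (Polynomial.le_natDegree_of_mem_supp i hi).trans (by omega)
  have hc : F.coeff i = Q.coeff i * r := by rw [hR, Polynomial.coeff_mul_C]
  have h1 : (Q.coeff i).natAbs ≤ (F.coeff i).natAbs := by
    rw [hc, Int.natAbs_mul]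
    exact Nat.le_mul_of_pos_right _ (Int.natAbs_pos.mpr hr)
  have h2 : (F.coeff i).natAbs ≤ K := by
    interval_cases i
    · rw [c0]; rw [Int.abs_eq_natAbs] at hD; exact_mod_cast hD
    · rw [c1]; rw [Int.abs_eq_natAbs] at hB; exact_mod_cast hB
    · rw [c2]; rw [Int.abs_eq_natAbs] at hA; exact_mod_cast hA
  exact h1.trans h2

theorem qp_quad (p p' q q' b : ℤ) (β α : ℝ) (hb : 2 ≤ b) (hβ : β ^ 2 = b * β + 1)
    (hbβ : (b : ℝ) < β) (hirr : Irrational β) (hq' : 0 ≤ q') (hqq : q' ≤ q) (hq : 1 ≤ q)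
    (hp : 0 ≤ p) (hpq : p ≤ q) (hp' : 0 ≤ p') (hpq' : p' ≤ q')
    (hdet : |p * q' - p' * q| = 1) (hα : α * (q * β + q') = p * β + p') :
    IsAlgDeg α 2 ∧ (algHeight α : ℝ) ≤ 8 * b * q ^ 2 ∧ (b : ℝ) ≤ 3 * algHeight α := by
  have hbR : (2 : ℝ) ≤ b := by exact_mod_cast hb
  have hqR : (1 : ℝ) ≤ q := by exact_mod_cast hq
  have hq'R : (0 : ℝ) ≤ q' := by exact_mod_cast hq'
  have hpR : (0 : ℝ) ≤ p := by exact_mod_cast hp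
  have hp'R : (0 : ℝ) ≤ p' := by exact_mod_cast hp'
  have hpqR : (p : ℝ) ≤ q := by exact_mod_cast hpq
  have hpq'R : (p' : ℝ) ≤ q' := by exact_mod_cast hpq'
  have hβ0 : 0 < β := by linarith
  have hqβ : (q : ℝ) * b ≤ q * β + q' := by nlinarith
  have hden : 0 < (q : ℝ) * β + q' := by nlinarith
  have hα0 : 0 ≤ α := by
    have : α = (p * β + p') / (q * β + q') := by field_simp; linarith
    rw [this]; positivity
  have hα1 : α ≤ 1 := by
    have : α = (p * β + p') / (q * β + q') := by field_simp; linarith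
    rw [this, div_le_one hden]; nlinarith
  have hdetR : |(p : ℝ) * q' - p' * q| = 1 := by exact_mod_cast hdet
  have hdel : |(p : ℝ) - q * α| * (q * β + q') = 1 := by
    have e : ((p : ℝ) - q * α) * (q * β + q') = p * q' - p' * q := by
      linear_combination (-(q:ℝ)) * hα
    rw [← hdetR, ← e, abs_mul, abs_of_pos hden]
  have hdel0 : (p : ℝ) - q * α ≠ 0 := by
    intro h
    rw [h] at hdel
    simp at hdel
  have hdelb : |(p : ℝ) - q * α| * (q * b) ≤ 1 := by
    rw [← hdel]; gcongr
  have hirα : Irrational α := by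
    rintro ⟨r, hr⟩
    apply hirr
    refine ⟨(q' * r - p') / (p - q * r), ?_⟩
    push_cast
    rw [hr, div_eq_iff hdel0]
    linear_combination hα
  have hrel : (q' * α - p') = β * (p - q * α) := by linear_combination hα
  obtain ⟨Q, hQ, hQd, hQα, hQh⟩ := qp_factor_height hirα (q' ^ 2 + b * q * q' - q ^ 2)
    (-2 * p' * q' - b * (q' * p + p' * q) + 2 * p * q) (p' ^ 2 + b * p * p' - p ^ 2)
    (by push_cast
        have : ((q':ℝ) * α - p') ^ 2 = b * (q' * α - p') * (p - q * α) + (p - q * α) ^ 2 := by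
          rw [hrel]; linear_combination (p - q * α) ^ 2 * hβ
        linear_combination this)
    (by rintro ⟨h1, h2, h3⟩
        have : (p * q' - p' * q) ^ 2 = 0 := by
          linear_combination p ^ 2 * h1 + p * q * h2 + q ^ 2 * h3
        rw [← sq_abs, hdet] at this
        norm_num at this)
    (8 * b * q ^ 2).toNat
    (by
      have e1 : 0 ≤ q' * (q - q') := mul_nonneg hq' (by linarith)
      have e2 : q' * q ≤ q ^ 2 := by nlinarith
      have e3 : 0 ≤ q' * q := by positivity
      have e4 : b * (q' * q) ≤ b * q ^ 2 := by gcongr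
      have e5 : 0 ≤ b * (q' * q) := by positivity
      have e6 : q ^ 2 ≤ b * q ^ 2 := by nlinarith
      have e7 : 0 ≤ q' ^ 2 := by positivity
      rw [Int.toNat_of_nonneg (by positivity), abs_le]
      constructor <;> nlinarith)
    (by
      have e1 : p' * q' ≤ q * q := by gcongr <;> linarith
      have e2 : q' * p ≤ q * q := by gcongr
      have e3 : p' * q ≤ q * q := by gcongr; linarith
      have e3' : p * q ≤ q * q := by gcongr
      have e4 : b * (q' * p + p' * q) ≤ b * (2 * q ^ 2) := by gcongr; linarith
      have e5 : 0 ≤ b * (q' * p + p' * q) := by positivity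
      have e6 : q ^ 2 ≤ b * q ^ 2 := by nlinarith
      have e7 : 0 ≤ p' * q' := by positivity
      have e8 : 0 ≤ p * q := by positivity
      rw [Int.toNat_of_nonneg (by positivity), abs_le]
      constructor <;> nlinarith)
    (by
      have e1 : p' * p' ≤ q * q := by gcongr <;> linarith
      have e2 : p * p' ≤ q * q := by gcongr; linarith
      have e3 : p * p ≤ q * q := by gcongr
      have e4 : b * (p * p') ≤ b * (q * q) := by gcongr
      have e5 : 0 ≤ b * (p * p') := by positivity
      have e6 : q ^ 2 ≤ b * q ^ 2 := by nlinarith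
      have e7 : 0 ≤ p' * p' := by positivity
      have e8 : 0 ≤ p * p := by positivity
      rw [Int.toNat_of_nonneg (by positivity), abs_le]
      constructor <;> nlinarith)
  refine ⟨⟨Q, hQ, hQd, hQα⟩, ?_, ?_⟩
  · have h1 : algHeight α ≤ (8 * b * q ^ 2).toNat :=
      (Nat.sInf_le ⟨Q, hQ, hQα, rfl⟩ : algHeight α ≤ polyHeight Q).trans hQh
    have h2 : ((8 * b * q ^ 2).toNat : ℤ) = 8 * b * q ^ 2 :=
      Int.toNat_of_nonneg (by positivity)
    have h3 : ((algHeight α : ℕ) : ℤ) ≤ 8 * b * q ^ 2 := by omega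
    exact_mod_cast h3
  · have hmem : algHeight α ∈ {h | ∃ P : Polynomial ℤ, Irreducible P ∧
        Polynomial.aeval α P = 0 ∧ polyHeight P = h} := Nat.sInf_mem ⟨_, Q, hQ, hQα, rfl⟩
    obtain ⟨P, hP, hPα, hPh⟩ := hmem
    have hPd2 := qp_two_le_natDegree hirα hP.ne_zero hPα
    have hPd : P.natDegree = 2 := by
      rw [qp_natDegree_irred hP (by omega) hPα, ← hQd,
        qp_natDegree_irred hQ (by omega) hQα]
    have hAle := qp_coeff_le P 2
    have hBle := qp_coeff_le P 1
    rw [hPh] at hAle hBle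
    have hA0 : P.coeff 2 ≠ 0 := by
      rw [← hPd]
      exact Polynomial.leadingCoeff_ne_zero.mpr hP.ne_zero
    have hroot : (P.coeff 2 : ℝ) * α ^ 2 + P.coeff 1 * α + P.coeff 0 = 0 := by
      rw [Polynomial.aeval_eq_sum_range, hPd] at hPα
      simp [Finset.sum_range_succ] at hPα
      linarith
    generalize P.coeff 2 = A at *
    generalize P.coeff 1 = B at *
    generalize P.coeff 0 = D at *
    have hAR : |(A : ℝ)| ≤ algHeight α := by
      have : |A| ≤ (algHeight α : ℤ) := by
        rw [Int.abs_eq_natAbs]; exact_mod_cast hAle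
      exact_mod_cast this
    have hBR : |(B : ℝ)| ≤ algHeight α := by
      have : |B| ≤ (algHeight α : ℤ) := by
        rw [Int.abs_eq_natAbs]; exact_mod_cast hBle
      exact_mod_cast this
    have hEeq : ((A * p ^ 2 + B * p * q + D * q ^ 2 : ℤ) : ℝ)
        = (p - q * α) * (A * (p + q * α) + B * q) := by
      push_cast
      linear_combination (q : ℝ) ^ 2 * hroot
    have hE0 : A * p ^ 2 + B * p * q + D * q ^ 2 ≠ 0 := by
      intro h
      rw [h, Int.cast_zero] at hEeq
      have h2 : (A : ℝ) * (p + q * α) + B * q = 0 := by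
        rcases mul_eq_zero.mp hEeq.symm with h | h
        · exact absurd h hdel0
        · exact h
      apply hirα
      refine ⟨(-(B * q) - A * p) / (A * q), ?_⟩
      have hA0R : (A : ℝ) ≠ 0 := by exact_mod_cast hA0
      push_cast
      rw [div_eq_iff (by positivity)]
      linear_combination -h2
    have hE1 : (1 : ℝ) ≤ |((A * p ^ 2 + B * p * q + D * q ^ 2 : ℤ) : ℝ)| := by
      exact_mod_cast Int.one_le_abs hE0
    rw [hEeq, abs_mul] at hE1
    have hbd : |(A : ℝ) * (p + q * α) + B * q| ≤ 3 * algHeight α * q := by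
      calc |(A : ℝ) * (p + q * α) + B * q| ≤ |(A : ℝ) * (p + q * α)| + |(B : ℝ) * q| :=
            abs_add_le _ _
        _ = |(A : ℝ)| * (p + q * α) + |(B : ℝ)| * q := by
            rw [abs_mul, abs_mul, abs_of_nonneg (by positivity : (0:ℝ) ≤ p + q * α),
              abs_of_nonneg (by positivity : (0:ℝ) ≤ q)]
        _ ≤ algHeight α * (q + q * 1) + algHeight α * q := by gcongr
        _ = _ := by ring
    have h1 : (1 : ℝ) ≤ |(p : ℝ) - q * α| * (3 * algHeight α * q) :=
      hE1.trans (by gcongr)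
    calc (b : ℝ) ≤ b * (|(p : ℝ) - q * α| * (3 * algHeight α * q)) := by nlinarith
      _ = (|(p : ℝ) - q * α| * (q * b)) * (3 * algHeight α) := by ring
      _ ≤ 1 * (3 * algHeight α) := by gcongr
      _ = _ := one_mul _

section CF
variable (a : ℕ → ℤ)

theorem qp_det (n : ℕ) :
    convP a (n + 1) * convQ a n - convP a n * convQ a (n + 1) = (-1) ^ n := by
  induction n with
  | zero => simp [convP, convQ]; ring
  | succ n ih =>
    simp only [convP, convQ]
    rw [pow_succ]
    linear_combination -ih

theorem qp_absdet (n : ℕ) :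
    |convP a (n + 1) * convQ a n - convP a n * convQ a (n + 1)| = 1 := by
  rw [qp_det]; simp

theorem qp_qpos (ha : ∀ i, 1 ≤ i → 1 ≤ a i) (n : ℕ) :
    1 ≤ convQ a n ∧ convQ a n ≤ convQ a (n + 1) := by
  induction n with
  | zero => simp [convQ]; exact ha 1 le_rfl
  | succ n ih =>
    refine ⟨by linarith, ?_⟩
    have := ha (n + 2) (by omega)
    simp only [convQ]
    nlinarith

theorem qp_pbd (ha0 : a 0 = 0) (ha : ∀ i, 1 ≤ i → 1 ≤ a i) (n : ℕ) :
    (0 ≤ convP a n ∧ convP a n ≤ convQ a n) ∧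
      (0 ≤ convP a (n + 1) ∧ convP a (n + 1) ≤ convQ a (n + 1)) := by
  induction n with
  | zero => simp [convP, convQ, ha0]; exact ha 1 le_rfl
  | succ n ih =>
    obtain ⟨⟨h1, h2⟩, h3, h4⟩ := ih
    refine ⟨⟨h3, h4⟩, ?_⟩
    have := ha (n + 2) (by omega)
    simp only [convP, convQ]
    constructor
    · positivity
    · gcongr

theorem qp_qstep (ha : ∀ i, 1 ≤ i → 1 ≤ a i) (n : ℕ) :
    a (n + 1) * convQ a n ≤ convQ a (n + 1) ∧
      convQ a (n + 1) ≤ (a (n + 1) + 1) * convQ a n := by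
  cases n with
  | zero => simp [convQ]
  | succ n =>
    have h1 := qp_qpos a ha n
    simp only [convQ]
    constructor <;> linarith

theorem qp_between (ha : ∀ i, 1 ≤ i → 1 ≤ a i) (n k : ℕ) :
    (0 ≤ (-1) ^ n * (convP a (n + k) * convQ a n - convP a n * convQ a (n + k)) ∧
     convQ a (n + 1) * ((-1) ^ n * (convP a (n + k) * convQ a n - convP a n * convQ a (n + k)))
      ≤ convQ a (n + k)) ∧
    (0 ≤ (-1) ^ n * (convP a (n + (k+1)) * convQ a n - convP a n * convQ a (n + (k+1))) ∧
     convQ a (n + 1) *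
       ((-1) ^ n * (convP a (n + (k+1)) * convQ a n - convP a n * convQ a (n + (k+1))))
      ≤ convQ a (n + (k+1))) := by
  induction k with
  | zero =>
    have h := qp_det a n
    have h1 := qp_qpos a ha n
    simp only [add_zero, zero_add, h, sub_self, mul_zero, le_refl, true_and]
    rw [← mul_pow]
    simp
    linarith
  | succ k ih =>
    refine ⟨ih.2, ?_⟩
    obtain ⟨⟨h1, h2⟩, h3, h4⟩ := ih
    have hp : convP a (n + (k + 1 + 1)) =
      a (n + (k + 1 + 1)) * convP a (n + (k + 1)) + convP a (n + k) := rfl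
    have hq : convQ a (n + (k + 1 + 1)) =
      a (n + (k + 1 + 1)) * convQ a (n + (k + 1)) + convQ a (n + k) := rfl
    have hA := ha (n + (k + 1 + 1)) (by omega)
    rw [hp, hq]
    generalize a (n + (k + 1 + 1)) = A at *
    generalize convP a (n + (k + 1)) = x at *
    generalize convQ a (n + (k + 1)) = y at *
    generalize convP a (n + k) = z at *
    generalize convQ a (n + k) = t at *
    have h5 := mul_nonneg (by linarith : 0 ≤ A) h3
    have h6 := mul_le_mul_of_nonneg_left h4 (by linarith : 0 ≤ A)
    constructor
    · linarith
    · linarith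

theorem qp_dist (ha : ∀ i, 1 ≤ i → 1 ≤ a i) (ξ : ℝ) (hξ : IsCFValue a ξ) (n : ℕ) :
    |ξ - convP a n / convQ a n| ≤ 1 / ((convQ a n : ℝ) * convQ a (n + 1)) := by
  have ht : Filter.Tendsto (fun m => |(convP a m : ℝ) / (convQ a m : ℝ)
      - convP a n / convQ a n|) atTop (nhds |ξ - convP a n / convQ a n|) :=
    (Filter.Tendsto.sub_const hξ _).abs
  refine le_of_tendsto ht ?_
  filter_upwards [eventually_ge_atTop n] with m hm
  obtain ⟨k, rfl⟩ := Nat.exists_eq_add_of_le hm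
  obtain ⟨⟨h1, h2⟩, -⟩ := qp_between a ha n k
  have q1 : (1 : ℝ) ≤ convQ a n := by exact_mod_cast (qp_qpos a ha n).1
  have q2 : (1 : ℝ) ≤ convQ a (n + 1) := by exact_mod_cast (qp_qpos a ha (n + 1)).1
  have q3 : (1 : ℝ) ≤ convQ a (n + k) := by exact_mod_cast (qp_qpos a ha (n + k)).1
  have h3 : (convQ a (n + 1) : ℝ) *
      |(convP a (n + k) : ℝ) * convQ a n - convP a n * convQ a (n + k)|
      ≤ convQ a (n + k) := by
    rw [← abs_of_nonneg h1, abs_mul, abs_pow] at h2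
    simp at h2
    exact_mod_cast h2
  have h4 : (convP a (n + k) : ℝ) / convQ a (n + k) - convP a n / convQ a n =
      (convP a (n + k) * convQ a n - convP a n * convQ a (n + k)) /
        (convQ a (n + k) * convQ a n) := by
    field_simp
  rw [h4, abs_div, abs_of_pos (by positivity : (0:ℝ) < convQ a (n + k) * convQ a n),
    div_le_div_iff₀ (by positivity) (by positivity)]
  nlinarith

theorem qp_upper (ha : ∀ i, 1 ≤ i → 1 ≤ a i) (N b : ℕ) (l : ℕ)
    (hc : ∀ i, N < i → i ≤ N + l → a i = b) :
    (b : ℤ) ^ l * convQ a N ≤ convQ a (N + l) ∧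
      convQ a (N + l) ≤ ((b : ℤ) + 1) ^ l * convQ a N := by
  induction l with
  | zero => simp
  | succ l ih =>
    obtain ⟨h1, h2⟩ := ih (fun i hi hi' => hc i hi (by omega))
    obtain ⟨h3, h4⟩ := qp_qstep a ha (N + l)
    rw [hc (N + l + 1) (by omega) (by omega)] at h3 h4
    rw [← add_assoc]
    constructor
    · calc (b : ℤ) ^ (l + 1) * convQ a N = b * ((b : ℤ) ^ l * convQ a N) := by ring
        _ ≤ b * convQ a (N + l) := by gcongr
        _ ≤ _ := h3
    · calc _ ≤ _ := h4
        _ ≤ ((b : ℤ) + 1) * (((b : ℤ) + 1) ^ l * convQ a N) := by gcongr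
        _ = _ := by ring

theorem qp_alpha (n b l : ℕ) (hc : ∀ i, n + 1 < i → i ≤ n + 1 + l → a i = b) (α β : ℝ)
    (hβ : β ^ 2 = b * β + 1)
    (h : α * (convQ a (n + 1) * β + convQ a n) = convP a (n + 1) * β + convP a n) :
    α * (convQ a (n + l + 1) * β + convQ a (n + l)) =
      convP a (n + l + 1) * β + convP a (n + l) := by
  induction l with
  | zero => exact h
  | succ l ih =>
    have h1 := ih (fun i hi hi' => hc i hi (by omega))
    have hp : convP a (n + (l + 1) + 1) =
      a (n + (l + 1) + 1) * convP a (n + l + 1) + convP a (n + l) := rfl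
    have hq : convQ a (n + (l + 1) + 1) =
      a (n + (l + 1) + 1) * convQ a (n + l + 1) + convQ a (n + l) := rfl
    rw [hp, hq, hc _ (by omega) (by omega), ← add_assoc]
    push_cast
    linear_combination β * h1 - (α * convQ a (n + l + 1) - convP a (n + l + 1)) * hβ

end CF

theorem qp_beta (b : ℕ) (hb : 2 ≤ b) : ∃ β : ℝ, β ^ 2 = b * β + 1 ∧ (b : ℝ) < β ∧
    β < b + 1 ∧ Irrational β := by
  have hbR : (2 : ℝ) ≤ b := by exact_mod_cast hb
  have hs : Real.sqrt ((b ^ 2 + 4 : ℕ) : ℝ) ^ 2 = (b : ℝ) ^ 2 + 4 := by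
    rw [Real.sq_sqrt (by positivity)]; push_cast; ring
  have hs0 : 0 ≤ Real.sqrt ((b ^ 2 + 4 : ℕ) : ℝ) := Real.sqrt_nonneg _
  have hirr : Irrational (Real.sqrt ((b ^ 2 + 4 : ℕ) : ℝ)) := by
    rw [irrational_sqrt_natCast_iff]
    rintro ⟨r, hr⟩
    have h1 : b < r := by nlinarith
    have h2 : r < b + 1 := by nlinarith
    omega
  refine ⟨(b + Real.sqrt ((b ^ 2 + 4 : ℕ) : ℝ)) / 2, ?_, ?_, ?_, ?_⟩
  · nlinarith
  · nlinarith
  · nlinarith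
  · have := (hirr.natCast_add b).div_natCast (m := 2) (by norm_num)
    exact_mod_cast this

theorem qp_ana (ξ α β b Q Q' P P' R : ℝ) (hbR : 2 ≤ b) (hbβ : b < β) (hβb : β < b + 1)
    (hbQ : b ≤ Q) (hR : Q * (100 * Q) ≤ R) (hdist : |ξ - P / Q| ≤ 1 / (Q * R))
    (hQ'1 : 1 ≤ Q') (hQ'Q : Q' ≤ Q) (hα2 : α * (Q * β + Q') = P * β + P')
    (hdetR : |P * Q' - P' * Q| = 1) : 0 < |ξ - α| ∧ |ξ - α| ≤ Q⁻¹ := by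
  have hQ2 : 2 ≤ Q := by linarith
  have hQ0 : 0 < Q := by linarith
  have hβ0 : 0 < β := by linarith
  have hden2 : 0 < Q * β + Q' := by positivity
  have e : (α - P / Q) * (Q * (Q * β + Q')) = -(P * Q' - P' * Q) := by
    field_simp
    linear_combination Q * hα2
  have e2 : |α - P / Q| = 1 / (Q * (Q * β + Q')) := by
    rw [eq_div_iff (by positivity), ← hdetR, ← abs_neg (P * Q' - P' * Q), ← e, abs_mul,
      abs_of_pos (by positivity : 0 < Q * (Q * β + Q'))]
  have hξ1 : |ξ - P / Q| ≤ 1 / (100 * Q ^ 3) := by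
    refine hdist.trans ?_
    apply one_div_le_one_div_of_le (by positivity)
    calc 100 * Q ^ 3 = Q * (Q * (100 * Q)) := by ring
      _ ≤ Q * R := by gcongr
  have hlow : 1 / (100 * Q ^ 3) < |α - P / Q| := by
    rw [e2]
    apply one_div_lt_one_div_of_lt (by positivity)
    have h0 : Q * β ≤ Q * (Q + 1) := by gcongr; linarith
    have : Q * β + Q' < 100 * Q ^ 2 := by nlinarith
    calc Q * (Q * β + Q') < Q * (100 * Q ^ 2) := by gcongr
      _ = _ := by ring
  have hup : |α - P / Q| ≤ 1 / (2 * Q) := by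
    rw [e2]
    apply one_div_le_one_div_of_le (by positivity)
    have : 2 * 1 ≤ Q * β := mul_le_mul hQ2 (by linarith) (by norm_num) hQ0.le
    rw [mul_comm]
    gcongr
    linarith
  have hup2 : 1 / (100 * Q ^ 3) ≤ 1 / (2 * Q) := by
    apply one_div_le_one_div_of_le (by positivity)
    have : 1 ≤ Q ^ 2 := by nlinarith
    calc 2 * Q ≤ 100 * (Q * 1) := by linarith
      _ ≤ 100 * (Q * Q ^ 2) := by gcongr
      _ = _ := by ring
  constructor
  · rw [abs_pos]
    intro h
    rw [sub_eq_zero] at h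
    rw [h] at hξ1
    linarith
  · have h3 : |ξ - α| ≤ |ξ - P / Q| + |α - P / Q| := by
      rw [abs_sub_comm α]
      exact abs_sub_le _ _ _
    have h4 : 1 / (2 * Q) + 1 / (2 * Q) = Q⁻¹ := by field_simp; norm_num
    linarith

theorem qp_key (b : ℕ) (l n : ℕ) (hl : 0 < l) (a : ℕ → ℤ) (ha0 : a 0 = 0)
    (ha : ∀ i, 1 ≤ i → 1 ≤ a i) (ξ : ℝ) (hξ : IsCFValue a ξ)
    (hc : ∀ i, n + 1 < i → i ≤ n + 1 + l → a i = b)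
    (h1 : 100 * convQ a (n + 1) ≤ b)
    (h2 : 100 * convQ a (n + l + 1) ≤ a (n + l + 2)) :
    ∃ α : ℝ, IsAlgDeg α 2 ∧ (algHeight α : ℝ) ≤ (b : ℝ) ^ 3 ∧ (b : ℝ) ≤ 3 * algHeight α ∧
      0 < |ξ - α| ∧ |ξ - α| ≤ ((b : ℝ) ^ l)⁻¹ := by
  have hq := qp_qpos a ha n
  have hq1 := qp_qpos a ha (n + 1)
  have hp := qp_pbd a ha0 ha n
  have hb : 2 ≤ b := by omega
  obtain ⟨β, hβ, hbβ, hβb, hirr⟩ := qp_beta b hb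
  have hbR : (2 : ℝ) ≤ b := by exact_mod_cast hb
  have hqR : (1 : ℝ) ≤ convQ a n := by exact_mod_cast hq.1
  have hq1R : (1 : ℝ) ≤ convQ a (n + 1) := by exact_mod_cast hq1.1
  have hden : 0 < (convQ a (n + 1) : ℝ) * β + convQ a n := by
    have : 0 < β := by linarith
    positivity
  obtain ⟨α, hα⟩ : ∃ α : ℝ, α * (convQ a (n + 1) * β + convQ a n) =
      convP a (n + 1) * β + convP a n :=
    ⟨(convP a (n + 1) * β + convP a n) / (convQ a (n + 1) * β + convQ a n),
      div_mul_cancel₀ _ hden.ne'⟩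
  obtain ⟨r1, r2, r3⟩ := qp_quad (convP a (n + 1)) (convP a n) (convQ a (n + 1)) (convQ a n) b β α
    (by exact_mod_cast hb) (by exact_mod_cast hβ) (by exact_mod_cast hbβ) hirr
    (by linarith) hq.2 hq1.1 hp.2.1 hp.2.2 hp.1.1 hp.1.2 (qp_absdet a n) hα
  have hα2 := qp_alpha a n b l hc α β hβ hα
  have hdet := qp_absdet a (n + l)
  have hbq := (qp_upper a ha (n + 1) b l hc).1
  rw [show n + 1 + l = n + l + 1 by ring] at hbq
  have hQ := qp_qpos a ha (n + l)
  have hst := (qp_qstep a ha (n + l + 1)).1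
  have hdist := qp_dist a ha ξ hξ (n + l + 1)
  have hh1 : (100 : ℝ) * convQ a (n + 1) ≤ b := by exact_mod_cast h1
  rw [show n + l + 1 + 1 = n + l + 2 by ring] at hst hdist
  have hR : (convQ a (n + l + 1) : ℝ) * (100 * convQ a (n + l + 1)) ≤ convQ a (n + l + 2) := by
    have : convQ a (n + l + 1) * (100 * convQ a (n + l + 1)) ≤ convQ a (n + l + 2) := by
      nlinarith
    exact_mod_cast this
  have hbqR : (b : ℝ) ^ l ≤ convQ a (n + l + 1) := by
    have : (b : ℤ) ^ l ≤ convQ a (n + l + 1) := by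
      refine le_trans ?_ hbq
      have : (0 : ℤ) ≤ (b : ℤ) ^ l := by positivity
      nlinarith
    exact_mod_cast this
  have hbl : (b : ℝ) ≤ (b : ℝ) ^ l := le_self_pow₀ (by linarith) (by omega)
  have hdetR : |(convP a (n + l + 1) : ℝ) * convQ a (n + l) -
      convP a (n + l) * convQ a (n + l + 1)| = 1 := by exact_mod_cast hdet
  have hQ'1 : (1 : ℝ) ≤ convQ a (n + l) := by exact_mod_cast hQ.1
  have hQ'Q : (convQ a (n + l) : ℝ) ≤ convQ a (n + l + 1) := by exact_mod_cast hQ.2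
  obtain ⟨f1, f2⟩ := qp_ana ξ α β b _ _ _ _ _ hbR hbβ hβb (hbl.trans hbqR) hR hdist hQ'1 hQ'Q
    hα2 hdetR
  refine ⟨α, r1, ?_, by exact_mod_cast r3, f1, f2.trans (by gcongr)⟩
  refine r2.trans ?_
  have h8 : (8 : ℝ) * (convQ a (n + 1)) ^ 2 ≤ (b : ℝ) ^ 2 := by nlinarith
  push_cast
  calc (8 : ℝ) * b * (convQ a (n + 1)) ^ 2 = b * (8 * (convQ a (n + 1)) ^ 2) := by ring
    _ ≤ b * (b : ℝ) ^ 2 := by gcongr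
    _ = _ := by ring

theorem qp_growth
    (b lam : ℕ → ℕ) (hb : ∀ n, 0 < b n) (hlam : ∀ n, 0 < lam n)
    (hbtop : Filter.Tendsto b Filter.atTop Filter.atTop)
    (hgrow : Filter.Tendsto (fun n => Real.log (b (n + 1)) /
        ∑ k ∈ Finset.range (n + 1), (lam k : ℝ) * Real.log (b k))
      Filter.atTop Filter.atTop)
    (a : ℕ → ℤ) (ha : ∀ i, 1 ≤ i → 1 ≤ a i)
    (hblock : ∀ j i : ℕ, (∑ k ∈ Finset.range j, lam k) < i →
      i ≤ ∑ k ∈ Finset.range (j + 1), lam k → a i = (b j : ℤ)) :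
    ∀ᶠ j in atTop, 100 * convQ a (∑ k ∈ Finset.range j, lam k) ≤ b j := by
  set S : ℕ → ℕ := fun j => ∑ k ∈ Finset.range j, lam k with hS
  set T : ℕ → ℝ := fun j => ∑ k ∈ Finset.range j, (lam k : ℝ) * Real.log (b k) with hT
  have hlog0 : ∀ k, 0 ≤ Real.log (b k) := fun k => Real.log_natCast_nonneg _
  have hqp : ∀ n, (1 : ℝ) ≤ convQ a n := fun n => by exact_mod_cast (qp_qpos a ha n).1
  obtain ⟨K, hK⟩ := (hbtop.eventually_ge_atTop 2).exists_forall_of_atTop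
  obtain ⟨C, hC⟩ : ∃ C : ℝ, ∀ j, K ≤ j → Real.log (convQ a (S j)) ≤ C + 2 * T j := by
    refine ⟨Real.log (convQ a (S K)) - 2 * T K, fun j hj => ?_⟩
    induction j, hj using Nat.le_induction with
    | base => linarith
    | succ j hj ih =>
      have hSs : S (j + 1) = S j + lam j := Finset.sum_range_succ _ _
      have hTs : T (j + 1) = T j + lam j * Real.log (b j) := Finset.sum_range_succ _ _
      have hu := (qp_upper a ha (S j) (b j) (lam j)
        (fun i hi hi' => hblock j i hi (by rw [Finset.sum_range_succ]; exact hi'))).2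
      rw [← hSs] at hu
      have hb2 : (2 : ℝ) ≤ b j := by exact_mod_cast hK j hj
      have huR : (convQ a (S (j + 1)) : ℝ) ≤ ((b j : ℝ) ^ 2) ^ lam j * convQ a (S j) := by
        have h1 : (convQ a (S (j + 1)) : ℝ) ≤ ((b j : ℝ) + 1) ^ lam j * convQ a (S j) := by
          exact_mod_cast hu
        refine h1.trans ?_
        have := hqp (S j)
        gcongr
        nlinarith
      have h2 := Real.log_le_log (by linarith [hqp (S (j + 1))]) huR
      rw [Real.log_mul (by positivity) (by linarith [hqp (S j)]), Real.log_pow, Real.log_pow] at h2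
      push_cast at h2
      rw [hTs]
      linarith
  have hTtop : Filter.Tendsto (fun n => T (n + 1)) atTop atTop := by
    have h1 : Filter.Tendsto (fun n => Real.log (b n)) atTop atTop :=
      Real.tendsto_log_atTop.comp (tendsto_natCast_atTop_atTop.comp hbtop)
    refine tendsto_atTop_mono (fun n => ?_) h1
    have h2 : T (n + 1) = T n + lam n * Real.log (b n) := Finset.sum_range_succ _ _
    have h3 : 0 ≤ T n := Finset.sum_nonneg fun k _ => mul_nonneg (by positivity) (hlog0 k)
    have h4 : (1 : ℝ) ≤ lam n := by exact_mod_cast hlam n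
    nlinarith [hlog0 n]
  suffices h : ∀ᶠ n in atTop, 100 * convQ a (S (n + 1)) ≤ b (n + 1) by
    obtain ⟨m, hm⟩ := h.exists_forall_of_atTop
    filter_upwards [eventually_ge_atTop (m + 1)] with j hj
    obtain ⟨t, rfl⟩ := Nat.exists_eq_add_of_le' (show 1 ≤ j by omega)
    exact hm t (by omega)
  filter_upwards [hTtop.eventually_ge_atTop (C + Real.log 100), hTtop.eventually_ge_atTop 1,
    hgrow.eventually_ge_atTop 3, eventually_ge_atTop K] with n h1 h2 h3 h4
  have h5 : 3 * T (n + 1) ≤ Real.log (b (n + 1)) := (le_div_iff₀ (by linarith)).mp h3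
  have h6 := hC (n + 1) (by omega)
  have h7 : Real.log (100 * convQ a (S (n + 1))) ≤ Real.log (b (n + 1)) := by
    rw [Real.log_mul (by norm_num) (by linarith [hqp (S (n + 1))])]
    linarith
  have h8 := (Real.log_le_log_iff (by linarith [hqp (S (n + 1))])
    (by exact_mod_cast hb (n + 1))).mp h7
  exact_mod_cast h8

/-- Under the growth hypotheses on `(b n)`, `(lam n)`, the quasi-periodic continued fraction
`ξ = [0; b 0 ^ (lam 0), b 1 ^ (lam 1), …]` satisfies `w*_{=2}(ξ) = +∞`: for every `w > 0`
there are real quadratic irrationals `α` of arbitrarily large height with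
`0 < |ξ - α| ≤ H(α) ^ (-w)`. -/
theorem quasiPeriodic_wEqStar_two_eq_top
    (b lam : ℕ → ℕ) (hb : ∀ n, 0 < b n) (hlam : ∀ n, 0 < lam n)
    (hbtop : Filter.Tendsto b Filter.atTop Filter.atTop)
    (hlamtop : Filter.Tendsto lam Filter.atTop Filter.atTop)
    (hgrow : Filter.Tendsto (fun n => Real.log (b (n + 1)) /
        ∑ k ∈ Finset.range (n + 1), (lam k : ℝ) * Real.log (b k))
      Filter.atTop Filter.atTop)
    (a : ℕ → ℤ) (ha0 : a 0 = 0)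
    (hblock : ∀ j i : ℕ, (∑ k ∈ Finset.range j, lam k) < i →
      i ≤ ∑ k ∈ Finset.range (j + 1), lam k → a i = (b j : ℤ))
    (ξ : ℝ) (hξ : IsCFValue a ξ)
    : wEqStar ξ 2 = ⊤ ∧
      ∀ w : ℝ, 0 < w → ∀ H₀ : ℝ, ∃ α : ℝ, IsAlgDeg α 2 ∧ H₀ ≤ (algHeight α : ℝ) ∧
        0 < |ξ - α| ∧ |ξ - α| ≤ (algHeight α : ℝ) ^ (-w) := by
  have ha : ∀ i, 1 ≤ i → 1 ≤ a i := by
    intro i hi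
    have hex : ∃ j, i ≤ ∑ k ∈ Finset.range (j + 1), lam k := by
      refine ⟨i, ?_⟩
      calc i ≤ i + 1 := by omega
        _ = ∑ k ∈ Finset.range (i + 1), 1 := by simp
        _ ≤ _ := Finset.sum_le_sum fun k _ => hlam k
    classical
    have hj := Nat.find_spec hex
    have hlt : ∑ k ∈ Finset.range (Nat.find hex), lam k < i := by
      rcases Nat.eq_zero_or_pos (Nat.find hex) with h | h
      · rw [h]; simp; omega
      · have := Nat.find_min hex (Nat.sub_lt h one_pos)
        rw [show Nat.find hex - 1 + 1 = Nat.find hex by omega] at this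
        omega
    rw [hblock _ i hlt hj]
    exact_mod_cast hb _
  have hg := qp_growth b lam hb hlam hbtop hgrow a ha hblock
  have main : ∀ w : ℝ, 0 < w → ∀ H₀ : ℝ, ∃ α : ℝ, IsAlgDeg α 2 ∧ H₀ ≤ (algHeight α : ℝ) ∧
        0 < |ξ - α| ∧ |ξ - α| ≤ (algHeight α : ℝ) ^ (-w) := by
    intro w hw H₀
    have hbR : Filter.Tendsto (fun n => (b n : ℝ)) atTop atTop :=
      tendsto_natCast_atTop_atTop.comp hbtop
    have hlR : Filter.Tendsto (fun n => (lam n : ℝ)) atTop atTop :=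
      tendsto_natCast_atTop_atTop.comp hlamtop
    obtain ⟨j, g1, g2, hbj, hlj, hj1⟩ := (hg.and (((tendsto_add_atTop_nat 1).eventually hg).and
      ((hbR.eventually_ge_atTop (3 * H₀)).and ((hlR.eventually_ge_atTop (3 * w)).and
      (eventually_ge_atTop 1))))).exists
    obtain ⟨n, hn⟩ : ∃ n, ∑ k ∈ Finset.range j, lam k = n + 1 := by
      refine Nat.exists_eq_add_one.mpr ?_
      exact Finset.sum_pos (fun k _ => hlam k) ⟨0, by simp; omega⟩
    have hn1 : ∑ k ∈ Finset.range (j + 1), lam k = n + lam j + 1 := by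
      rw [Finset.sum_range_succ, hn]; ring
    have hn2 : n + lam j + 1 < n + lam j + 2 := by omega
    have hnext : a (n + lam j + 2) = b (j + 1) := by
      apply hblock
      · rw [hn1]; omega
      · rw [Finset.sum_range_succ, hn1]
        have := hlam (j + 1)
        omega
    rw [hn] at g1
    rw [hn1] at g2
    obtain ⟨α, r1, r2, r3, r4, r5⟩ := qp_key (b j) (lam j) n (hlam j) a ha0 ha ξ hξ
      (fun i hi hi' => hblock j i (by rw [hn]; exact hi) (by rw [hn1]; omega)) g1
      (by rw [hnext]; exact g2)
    refine ⟨α, r1, by linarith, r4, r5.trans ?_⟩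
    have hb1 : (1 : ℝ) ≤ b j := by exact_mod_cast hb j
    have hpos : (0 : ℝ) < algHeight α := by linarith
    rw [Real.rpow_neg hpos.le]
    apply inv_anti₀ (by positivity)
    calc (algHeight α : ℝ) ^ w ≤ ((b j : ℝ) ^ 3) ^ w := by gcongr
      _ = (b j : ℝ) ^ (3 * w) := by
        rw [← Real.rpow_natCast, ← Real.rpow_mul (by positivity)]; norm_num
      _ ≤ (b j : ℝ) ^ (lam j : ℝ) := Real.rpow_le_rpow_of_exponent_le hb1 hlj
      _ = _ := Real.rpow_natCast _ _
  refine ⟨?_, main⟩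
  rw [EReal.eq_top_iff_forall_lt]
  intro y
  set w : ℝ := max y 0 + 1 with hwdef
  have hw : 0 < w := by positivity
  have hyw : y < w := by
    have := le_max_left y 0
    linarith
  refine lt_of_lt_of_le (EReal.coe_lt_coe_iff.mpr hyw) ?_
  refine le_sSup ⟨w, rfl, fun H₀ => ?_⟩
  obtain ⟨α, h1, h2, h3, h4⟩ := main (w + 1) (by linarith) (max H₀ 1)
  have hpos : (0 : ℝ) < algHeight α := by
    have := le_max_right H₀ 1
    linarith
  refine ⟨algHeight α, (le_max_left _ _).trans h2, α, h1, le_rfl, h3, h4.trans (le_of_eq ?_)⟩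
  rw [← Real.rpow_neg_one, ← Real.rpow_add hpos]
  congr 1
  ring
end

section
/- There exist uncountably many Liouville numbers ξ with w*_{=2}(ξ) = +∞, i.e. such that for every w > 0 there are real quadratic irrationals α of arbitrarily large height satisfying 0 < |ξ − α| ≤ H(α)^{−w}. -/
open Filter Finset Polynomial

lemma nd_ne_zero {α : ℝ} {P : Polynomial ℤ} (hP : P ≠ 0) (h : Polynomial.aeval α P = 0) :
    P.natDegree ≠ 0 := by
  intro h0
  rw [Polynomial.eq_C_of_natDegree_eq_zero h0] at h
  simp at h
  apply hP
  rw [Polynomial.eq_C_of_natDegree_eq_zero h0, h]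
  simp

lemma nd_eq_minpoly {α : ℝ} {P : Polynomial ℤ} (hP : Irreducible P)
    (h : Polynomial.aeval α P = 0) : P.natDegree = (minpoly ℚ α).natDegree := by
  have h0 := nd_ne_zero hP.ne_zero h
  have hprim := hP.isPrimitive h0
  have hirr := (Polynomial.IsPrimitive.Int.irreducible_iff_irreducible_map_cast hprim).1 hP
  have hz : Polynomial.aeval α (P.map (Int.castRingHom ℚ)) = 0 := by
    rw [← h]
    exact Polynomial.aeval_map_algebraMap ℚ α P
  have := minpoly.eq_of_irreducible hirr hz
  rw [← this, Polynomial.natDegree_mul_C]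
  · exact (Polynomial.natDegree_map_eq_of_injective Int.cast_injective P).symm
  · simpa using hirr.ne_zero

lemma finite_small (n : ℕ) : {α : ℝ | IsAlgDeg α 2 ∧ algHeight α < n}.Finite := by
  have hU : (Set.Icc (-(n:ℤ)) n).Finite := Set.finite_Icc _ _
  refine (Polynomial.bUnion_roots_finite (algebraMap ℤ ℝ) 2 hU).subset ?_
  rintro α ⟨⟨Q, hQ, hQ2, hQα⟩, hh⟩
  have hne : {h | ∃ P : Polynomial ℤ, Irreducible P ∧ Polynomial.aeval α P = 0 ∧
      polyHeight P = h}.Nonempty := ⟨_, Q, hQ, hQα, rfl⟩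
  obtain ⟨P, hP, hPα, hPh⟩ := Nat.sInf_mem hne
  change polyHeight P = algHeight α at hPh
  have hd : P.natDegree = 2 := by rw [nd_eq_minpoly hP hPα, ← nd_eq_minpoly hQ hQα, hQ2]
  simp only [Set.mem_iUnion]
  refine ⟨P, ⟨hd.le, fun i => ?_⟩, ?_⟩
  · have : (P.coeff i).natAbs ≤ polyHeight P := by
      by_cases hi : i ∈ P.support
      · exact Finset.le_sup (f := fun i => (P.coeff i).natAbs) hi
      · rw [Polynomial.notMem_support_iff.1 hi]; simp
    rw [Set.mem_Icc]
    omega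
  · have hm : P.map (algebraMap ℤ ℝ) ≠ 0 :=
      (Polynomial.map_ne_zero_iff (RingHom.injective_int _)).2 hP.ne_zero
    simp only [Finset.mem_coe, Multiset.mem_toFinset]
    rw [Polynomial.mem_roots hm, Polynomial.IsRoot, Polynomial.eval_map_algebraMap]
    exact hPα

lemma isAlgDeg_of {α : ℝ} (hα : Irrational α) {Q : Polynomial ℤ} (hQ : Q ≠ 0)
    (hd : Q.natDegree ≤ 2) (h : Polynomial.aeval α Q = 0) : IsAlgDeg α 2 := by
  obtain ⟨f, hf, u, hu⟩ := WfDvdMonoid.exists_factors Q hQ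
  have h1 : Polynomial.aeval α f.prod = 0 := by
    rw [← hu, map_mul] at h
    rcases mul_eq_zero.1 h with h | h
    · exact h
    · exact absurd h ((u.isUnit.map (Polynomial.aeval α)).ne_zero)
  rw [map_multiset_prod, Multiset.prod_eq_zero_iff, Multiset.mem_map] at h1
  obtain ⟨P, hPf, hP⟩ := h1
  have hirr := hf P hPf
  have hdvd : P ∣ Q := (Multiset.dvd_prod hPf).trans ⟨u, hu.symm⟩
  have hle := (Polynomial.natDegree_le_of_dvd hdvd hQ).trans hd
  have h0 := nd_ne_zero hirr.ne_zero hP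
  have hne1 : P.natDegree ≠ 1 := by
    intro h1
    have ha : P.coeff 1 ≠ 0 := by
      rw [← h1]; simpa using hirr.ne_zero
    rw [Polynomial.eq_X_add_C_of_natDegree_le_one h1.le] at hP
    simp at hP
    apply hα
    refine ⟨-(P.coeff 0) / (P.coeff 1), ?_⟩
    have : (P.coeff 1 : ℝ) ≠ 0 := by exact_mod_cast ha
    push_cast
    field_simp
    linarith
  exact ⟨P, hirr, by omega, hP⟩

lemma isAlgDeg_sqrt (r : ℚ) : IsAlgDeg (√2 + r) 2 := by
  have hq : (r.den : ℤ) ≠ 0 := by simp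
  set b : ℤ := (r.den : ℤ) with hb
  let Q : Polynomial ℤ := C (b ^ 2) * X ^ 2 + C (-2 * r.num * b) * X + C (r.num ^ 2 - 2 * b ^ 2)
  have hd : Q.natDegree = 2 := Polynomial.natDegree_quadratic (pow_ne_zero 2 hq)
  refine isAlgDeg_of (Q := Q) (irrational_sqrt_two.add_ratCast r) ?_ hd.le ?_
  · intro h
    rw [h] at hd
    simp at hd
  · have hr : (r : ℝ) * b = r.num := by
      rw [hb]; exact_mod_cast Rat.mul_den_eq_num r
    have h2 : √2 ^ 2 = (2 : ℝ) := Real.sq_sqrt (by norm_num)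
    simp only [Q, map_add, map_mul, map_pow, Polynomial.aeval_X, Polynomial.aeval_C]
    simp
    rw [← hr]
    linear_combination (b : ℝ) ^ 2 * h2

lemma dense_quad (n : ℕ) : Dense {α : ℝ | IsAlgDeg α 2 ∧ n ≤ algHeight α} := by
  have h1 : Dense {α : ℝ | IsAlgDeg α 2} := by
    have : Dense ((fun x : ℝ => √2 + x) '' Set.range ((↑) : ℚ → ℝ)) :=
      (Homeomorph.addLeft (√2)).surjective.denseRange.dense_image
        (Homeomorph.addLeft (√2)).continuous Rat.denseRange_cast
    refine this.mono ?_
    rintro _ ⟨_, ⟨r, rfl⟩, rfl⟩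
    exact isAlgDeg_sqrt r
  refine (h1.sdiff_finite (finite_small n)).mono ?_
  rintro α ⟨h, h'⟩
  exact ⟨h, not_lt.1 fun hlt => h' ⟨h, hlt⟩⟩

lemma resid (n : ℕ) : {ξ : ℝ | ∃ α : ℝ, (IsAlgDeg α 2 ∧ n + 2 ≤ algHeight α) ∧
    |ξ - α| < (algHeight α : ℝ) ^ (-(n : ℝ))} ∈ residual ℝ := by
  apply residual_of_dense_open
  · have : {ξ : ℝ | ∃ α : ℝ, (IsAlgDeg α 2 ∧ n + 2 ≤ algHeight α) ∧
        |ξ - α| < (algHeight α : ℝ) ^ (-(n : ℝ))} =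
        ⋃ α ∈ {α : ℝ | IsAlgDeg α 2 ∧ n + 2 ≤ algHeight α},
          Metric.ball α ((algHeight α : ℝ) ^ (-(n : ℝ))) := by
      ext ξ
      simp [Real.dist_eq]
    rw [this]
    exact isOpen_biUnion fun _ _ => Metric.isOpen_ball
  · refine (dense_quad (n + 2)).mono ?_
    rintro α hα
    refine ⟨α, hα, ?_⟩
    have : 0 < algHeight α := by have := hα.2; omega
    rw [sub_self, abs_zero]
    positivity


/-- There exist uncountably many Liouville numbers `ξ` with `w*_{=2}(ξ) = +∞`: i.e. for every
`w > 0` there are real quadratic irrationals `α` of arbitrarily large height with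
`0 < |ξ - α| ≤ H(α) ^ (-w)`. Here `ξ` is Liouville in the sense that for every `w > 0` there
are integers `p, q` with `q ≥ 2` and `0 < |ξ - p/q| < q ^ (-w)`. -/
theorem uncountably_many_liouville_wEqStar_two :
    ∃ S : Set ℝ, ¬ S.Countable ∧ ∀ ξ ∈ S,
      (∀ w : ℝ, 0 < w → ∃ p q : ℤ, 2 ≤ q ∧ 0 < |ξ - (p : ℝ) / (q : ℝ)| ∧
        |ξ - (p : ℝ) / (q : ℝ)| < (q : ℝ) ^ (-w)) ∧
      (∀ w : ℝ, 0 < w → ∀ H₀ : ℝ, ∃ α : ℝ, IsAlgDeg α 2 ∧ H₀ ≤ (algHeight α : ℝ) ∧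
        0 < |ξ - α| ∧ |ξ - α| ≤ (algHeight α : ℝ) ^ (-w)) := by
  classical
  let S : Set ℝ := {ξ | Liouville ξ} ∩ ⋂ n : ℕ, {ξ : ℝ | ∃ α : ℝ,
    (IsAlgDeg α 2 ∧ n + 2 ≤ algHeight α) ∧ |ξ - α| < (algHeight α : ℝ) ^ (-(n : ℝ))}
  have hS : S ∈ residual ℝ :=
    inter_mem eventually_residual_liouville (countable_iInter_mem.2 resid)
  refine ⟨S, fun hc => ?_, ?_⟩
  · have hcompl : Sᶜ ∈ residual ℝ := by
      have : Sᶜ = ⋂ x ∈ S, {x}ᶜ := by ext y; simp only [Set.mem_compl_iff, Set.mem_iInter, Set.mem_singleton_iff]; exact ⟨fun h i hi e => h (e ▸ hi), fun h hy => h y hy rfl⟩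
      rw [this]
      refine (countable_bInter_mem hc).2 fun x _ => ?_
      exact residual_of_dense_open isOpen_compl_singleton (dense_compl_singleton x)
    have := (dense_of_mem_residual (inter_mem hS hcompl)).nonempty
    simp at this
  · rintro ξ ⟨hL, hξ⟩
    rw [Set.mem_iInter] at hξ
    change Liouville ξ at hL
    refine ⟨fun w hw => ?_, fun w hw H₀ => ?_⟩
    · obtain ⟨a, b, hb, hne, hlt⟩ := hL ⌈w⌉₊
      refine ⟨a, b, hb, abs_pos.2 (sub_ne_zero.2 hne), hlt.trans_le ?_⟩
      have hb' : (1 : ℝ) ≤ b := by exact_mod_cast hb.le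
      rw [one_div, ← Real.rpow_natCast, ← Real.rpow_neg (by linarith)]
      exact Real.rpow_le_rpow_of_exponent_le hb' (neg_le_neg (Nat.le_ceil w))
    · obtain ⟨α, ⟨hα, hh⟩, hlt⟩ := hξ (max ⌈w⌉₊ ⌈H₀⌉₊)
      have hn1 : w ≤ ((max ⌈w⌉₊ ⌈H₀⌉₊ : ℕ) : ℝ) :=
        (Nat.le_ceil w).trans (by exact_mod_cast le_max_left _ _)
      have hn2 : H₀ ≤ ((max ⌈w⌉₊ ⌈H₀⌉₊ : ℕ) : ℝ) :=
        (Nat.le_ceil H₀).trans (by exact_mod_cast le_max_right _ _)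
      generalize max ⌈w⌉₊ ⌈H₀⌉₊ = n at *
      have hh' : (n : ℝ) + 2 ≤ algHeight α := by exact_mod_cast hh
      have hn0 : (0 : ℝ) ≤ n := n.cast_nonneg
      refine ⟨α, hα, by linarith, ?_, hlt.le.trans ?_⟩
      · refine abs_pos.2 (sub_ne_zero.2 ?_)
        rintro rfl
        obtain ⟨P, hP, _, hPα⟩ := hα
        exact hL.transcendental ⟨P, hP.ne_zero, hPα⟩
      · exact Real.rpow_le_rpow_of_exponent_le (by linarith) (neg_le_neg hn1)
end

section
/- Let (b_n), (λ_n) be positive integer sequences satisfying b_n → ∞, λ_n → ∞, and log b_{n+1}/(∑_{k=0}^n λ_k log b_k) → ∞. For n ≥ 0, let α_n = [0; b₀^{λ₀}, …, bₙ^{λₙ}, \overline{b_{n+1}}]. Then for all sufficiently large n, log H(α_n) ≤ 3 log b_{n+1}. -/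
open Filter Finset Polynomial

lemma exists_irred_factor (F : Polynomial ℤ) (hF : F ≠ 0) (x : ℝ) (hx : aeval x F = 0) :
    ∃ P : Polynomial ℤ, Irreducible P ∧ aeval x P = 0 ∧ P ∣ F := by
  obtain ⟨f, hf, hprod⟩ := UniqueFactorizationMonoid.exists_prime_factors F hF
  obtain ⟨u, hu⟩ := hprod
  have h1 : aeval x f.prod = 0 := by
    have h2 : aeval x f.prod * aeval x (u : Polynomial ℤ) = 0 := by
      rw [← map_mul, hu, hx]
    rcases mul_eq_zero.mp h2 with h | h
    · exact h
    · exact absurd h ((u.isUnit.map (aeval x)).ne_zero)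
  rw [map_multiset_prod, Multiset.prod_eq_zero_iff, Multiset.mem_map] at h1
  obtain ⟨P, hP, hP0⟩ := h1
  exact ⟨P, (hf P hP).irreducible, hP0, (Multiset.dvd_prod hP).trans ⟨u, hu.symm⟩⟩

lemma natAbs_le_of_mul {x y c : ℤ} {H : ℕ} (hy : y ≠ 0) (h : x * y = c) (hc : c.natAbs ≤ H) :
    x.natAbs ≤ H := by
  rw [← h, Int.natAbs_mul] at hc
  exact (Nat.le_mul_of_pos_right _ (Int.natAbs_pos.mpr hy)).trans hc

lemma factor_coeff_le (F P : Polynomial ℤ) (hF : F ≠ 0) (hd : F.natDegree ≤ 2) (H : ℕ)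
    (hH : ∀ i, (F.coeff i).natAbs ≤ H) (hP : P ∣ F) (i : ℕ) : (P.coeff i).natAbs ≤ H := by
  obtain ⟨G, rfl⟩ := hP
  have hP0 : P ≠ 0 := left_ne_zero_of_mul hF
  have hG0 : G ≠ 0 := right_ne_zero_of_mul hF
  rw [natDegree_mul hP0 hG0] at hd
  by_cases hi : P.natDegree < i
  · rw [coeff_eq_zero_of_natDegree_lt hi]; simp
  have hlead : G.coeff G.natDegree ≠ 0 := by simpa using hG0
  by_cases hi2 : i = P.natDegree
  · refine natAbs_le_of_mul hlead ?_ (hH (i + G.natDegree))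
    rw [hi2, coeff_mul_degree_add_degree]; simp
  by_cases hg : G.natDegree = 0
  · rw [eq_C_of_natDegree_eq_zero hg] at hH hG0
    have := hH i
    rw [coeff_mul_C] at this
    exact natAbs_le_of_mul (by simpa using hG0) rfl this
  have hi0 : i = 0 := by omega
  have hg1 : G.natDegree = 1 := by omega
  subst hi0
  by_cases h0 : G.coeff 0 = 0
  · have h1 := hH 1
    rw [coeff_mul] at h1
    rw [Finset.Nat.sum_antidiagonal_eq_sum_range_succ_mk] at h1
    simp [Finset.sum_range_succ, h0] at h1
    rw [hg1] at hlead
    exact natAbs_le_of_mul hlead rfl (by rw [Int.natAbs_mul]; simpa [Int.natAbs_mul] using h1)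
  · exact natAbs_le_of_mul h0 (mul_coeff_zero P G).symm (hH 0)

lemma algHeight_le_quad (c2 c1 c0 : ℤ) (H : ℕ) (x : ℝ)
    (hne : c1 ^ 2 - 4 * c2 * c0 ≠ 0)
    (hx : (c2 : ℝ) * x ^ 2 + c1 * x + c0 = 0)
    (h2 : c2.natAbs ≤ H) (h1 : c1.natAbs ≤ H) (h0 : c0.natAbs ≤ H) : algHeight x ≤ H := by
  set F : Polynomial ℤ := C c2 * X ^ 2 + C c1 * X + C c0 with hFdef
  have hcf : ∀ i, F.coeff i = if i = 0 then c0 else if i = 1 then c1 else if i = 2 then c2 else 0 := by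
    intro i
    rcases i with _ | _ | _ | i <;>
      simp [hFdef, coeff_X, coeff_C, coeff_X_pow, -eq_intCast, -map_intCast]
  have hF : F ≠ 0 := by
    intro h
    have e0 := hcf 0
    have e1 := hcf 1
    have e2 := hcf 2
    simp [h] at e0 e1 e2
    apply hne
    simp [← e0, ← e1, ← e2]
  have hd : F.natDegree ≤ 2 := natDegree_quadratic_le
  have hH : ∀ i, (F.coeff i).natAbs ≤ H := by
    intro i
    rw [hcf]
    split_ifs <;> simp_all
  have hxF : aeval x F = 0 := by
    simp [hFdef]
    exact hx
  obtain ⟨P, hP, hPx, hPF⟩ := exists_irred_factor F hF x hxF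
  have hle : algHeight x ≤ polyHeight P := Nat.sInf_le ⟨P, hP, hPx, rfl⟩
  refine hle.trans ?_
  exact Finset.sup_le fun i _ => factor_coeff_le F P hF hd H hH hPF i

/-- The value of a sequence of convergents with eventually constant partial quotient `B`
is a root of an explicit quadratic. -/
lemma root_of_recurrence (p q : ℕ → ℤ) (B : ℤ) (hB : 1 ≤ B) (x : ℝ)
    (hp : ∀ k, p (k + 2) = B * p (k + 1) + p k)
    (hq : ∀ k, q (k + 2) = B * q (k + 1) + q k)
    (hq0 : 1 ≤ q 0) (hq1 : 1 ≤ q 1)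
    (hlim : Tendsto (fun k => (p k : ℝ) / (q k : ℝ)) atTop (nhds x)) :
    ((q 0 : ℝ) * x - p 0) ^ 2 + B * ((q 0 : ℝ) * x - p 0) * ((q 1 : ℝ) * x - p 1)
      - ((q 1 : ℝ) * x - p 1) ^ 2 = 0 := by
  have hqpos : ∀ k, 1 ≤ q k ∧ 1 ≤ q (k + 1) ∧ (k : ℤ) ≤ q (k + 1) := by
    intro k
    induction k with
    | zero => exact ⟨hq0, hq1, by simpa using by linarith⟩
    | succ k ih =>
      obtain ⟨i1, i2, i3⟩ := ih
      have := hq k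
      refine ⟨i2, ?_, ?_⟩
      · show 1 ≤ q (k + 2)
        nlinarith
      · show ((k + 1 : ℕ) : ℤ) ≤ q (k + 2)
        push_cast
        nlinarith
  set y : ℕ → ℤ := fun k => q 0 * p k - p 0 * q k with hy
  set z : ℕ → ℤ := fun k => q 1 * p k - p 1 * q k with hz
  have hyr : ∀ k, y (k + 2) = B * y (k + 1) + y k := by
    intro k; simp only [hy, hp, hq]; ring
  have hzr : ∀ k, z (k + 2) = B * z (k + 1) + z k := by
    intro k; simp only [hz, hp, hq]; ring
  have hzy : ∀ k, z (k + 1) = - y k ∧ z (k + 2) = - y (k + 1) := by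
    intro k
    induction k with
    | zero =>
      constructor
      · simp only [hy, hz]; ring
      · have := hzr 0
        simp only [zero_add] at this ⊢
        rw [this]; simp only [hy, hz]; ring
    | succ k ih =>
      refine ⟨ih.2, ?_⟩
      have h1 := hzr (k + 1)
      have h2 := hyr k
      show z (k + 3) = - y (k + 2)
      have h1' : z (k + 3) = B * z (k + 2) + z (k + 1) := h1
      rw [h1', h2, ih.1, ih.2]; ring
  set N : ℕ → ℤ := fun k => y k ^ 2 + B * y k * z k - z k ^ 2 with hN
  have hNstep : ∀ k, N (k + 2) = - N (k + 1) := by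
    intro k
    simp only [hN]
    rw [(hzy k).1, (hzy k).2, hyr k]; ring
  have hNabs : ∀ k, |N (k + 1)| = |N 1| := by
    intro k
    induction k with
    | zero => rfl
    | succ k ih => rw [hNstep, abs_neg, ih]
  set f : ℝ → ℝ := fun x => ((q 0 : ℝ) * x - p 0) ^ 2
    + B * ((q 0 : ℝ) * x - p 0) * ((q 1 : ℝ) * x - p 1) - ((q 1 : ℝ) * x - p 1) ^ 2 with hf
  have hfc : Continuous f := by simp only [hf]; fun_prop
  have hl1 : Tendsto (fun k => f ((p (k + 1) : ℝ) / (q (k + 1) : ℝ))) atTop (nhds (f x)) :=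
    (hfc.tendsto x).comp (hlim.comp (tendsto_add_atTop_nat 1))
  have hval : ∀ k, f ((p (k + 1) : ℝ) / (q (k + 1) : ℝ)) = (N (k + 1) : ℝ) / (q (k + 1) : ℝ) ^ 2 := by
    intro k
    have : (q (k + 1) : ℝ) ≠ 0 := by
      have := (hqpos k).2.1
      exact_mod_cast (by omega : q (k + 1) ≠ 0)
    simp only [hf, hN, hy, hz]
    push_cast
    field_simp
  have hqt : Tendsto (fun k => (q (k + 1) : ℝ)) atTop atTop := by
    refine tendsto_atTop_mono (fun k => ?_) tendsto_natCast_atTop_atTop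
    exact_mod_cast (hqpos k).2.2
  have hl2 : Tendsto (fun k => f ((p (k + 1) : ℝ) / (q (k + 1) : ℝ))) atTop (nhds 0) := by
    have hg : Tendsto (fun k => (|N 1| : ℝ) / (q (k + 1) : ℝ) ^ 2) atTop (nhds 0) :=
      Tendsto.const_div_atTop ((tendsto_pow_atTop (by norm_num)).comp hqt) _
    refine squeeze_zero_norm (fun k => ?_) hg
    rw [hval, norm_div, Real.norm_eq_abs, Real.norm_eq_abs, abs_of_nonneg (sq_nonneg (q (k + 1) : ℝ))]
    have := hNabs k
    have h' : |(N (k + 1) : ℝ)| = |(N 1 : ℝ)| := by exact_mod_cast this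
    rw [h']
  exact tendsto_nhds_unique hl1 hl2

lemma algHeight_le_of_recurrence (p q : ℕ → ℤ) (B : ℤ) (hB : 1 ≤ B) (x : ℝ)
    (hp : ∀ k, p (k + 2) = B * p (k + 1) + p k)
    (hq : ∀ k, q (k + 2) = B * q (k + 1) + q k)
    (hq0 : 1 ≤ q 0) (hq1 : 1 ≤ q 1)
    (hlim : Tendsto (fun k => (p k : ℝ) / (q k : ℝ)) atTop (nhds x))
    (hdet : (p 1 * q 0 - p 0 * q 1) ^ 2 = 1)
    (hp0 : 0 ≤ p 0) (hp1 : 0 ≤ p 1) (hpq0 : p 0 ≤ q 0) (hpq1 : p 1 ≤ q 1) (hqq : q 0 ≤ q 1) :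
    (algHeight x : ℤ) ≤ 6 * B * q 1 ^ 2 := by
  have hroot := root_of_recurrence p q B hB x hp hq hq0 hq1 hlim
  generalize p 0 = p0 at *
  generalize p 1 = p1 at *
  generalize q 0 = q0 at *
  generalize q 1 = q1 at *
  have A1 : ∀ u v : ℤ, 0 ≤ u → 0 ≤ v → u ≤ q1 → v ≤ q1 → 0 ≤ u * v ∧ u * v ≤ q1 ^ 2 := by
    intro u v hu hv h1 h2
    exact ⟨mul_nonneg hu hv, by nlinarith⟩
  have A2 : ∀ u v : ℤ, 0 ≤ u → 0 ≤ v → u ≤ q1 → v ≤ q1 →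
      0 ≤ B * (u * v) ∧ B * (u * v) ≤ B * q1 ^ 2 := by
    intro u v hu hv h1 h2
    have := A1 u v hu hv h1 h2
    exact ⟨mul_nonneg (by linarith) this.1, mul_le_mul_of_nonneg_left this.2 (by linarith)⟩
  have hBq : q1 ^ 2 ≤ B * q1 ^ 2 := by nlinarith [sq_nonneg q1]
  have key : algHeight x ≤ (6 * B * q1 ^ 2).natAbs := by
    apply algHeight_le_quad (q0 ^ 2 + B * (q0 * q1) - q1 ^ 2)
      (-(2 * (p0 * q0) + B * (p0 * q1) + B * (q0 * p1) - 2 * (p1 * q1)))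
      (p0 ^ 2 + B * (p0 * p1) - p1 ^ 2)
    · have : (-(2 * (p0 * q0) + B * (p0 * q1) + B * (q0 * p1) - 2 * (p1 * q1))) ^ 2
        - 4 * (q0 ^ 2 + B * (q0 * q1) - q1 ^ 2) * (p0 ^ 2 + B * (p0 * p1) - p1 ^ 2)
        = (B ^ 2 + 4) * (p1 * q0 - p0 * q1) ^ 2 := by ring
      rw [this, hdet]
      positivity
    · push_cast
      linear_combination hroot
    · have a := A1 q0 q0 (by omega) (by omega) (by omega) (by omega)
      have b := A2 q0 q1 (by omega) (by omega) (by omega) (by omega)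
      rw [← sq] at a
      rw [mul_assoc]
      omega
    · have a := A1 p0 q0 (by omega) (by omega) (by omega) (by omega)
      have b := A2 p0 q1 (by omega) (by omega) (by omega) (by omega)
      have c := A2 q0 p1 (by omega) (by omega) (by omega) (by omega)
      have d := A1 p1 q1 (by omega) (by omega) (by omega) (by omega)
      rw [mul_assoc 6]
      omega
    · have a := A1 p0 p0 (by omega) (by omega) (by omega) (by omega)
      have b := A2 p0 p1 (by omega) (by omega) (by omega) (by omega)
      have c := A1 p1 p1 (by omega) (by omega) (by omega) (by omega)
      rw [← sq] at a c
      rw [mul_assoc 6]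
      omega
  have hnn : 0 ≤ 6 * B * q1 ^ 2 := by positivity
  omega

lemma conv_basic (a : ℕ → ℤ) (ha0 : a 0 = 0) (ha : ∀ i, 1 ≤ i → 1 ≤ a i) (k : ℕ) :
    (0 ≤ convP a k ∧ convP a k ≤ convQ a k ∧ 1 ≤ convQ a k) ∧
    (0 ≤ convP a (k + 1) ∧ convP a (k + 1) ≤ convQ a (k + 1) ∧ 1 ≤ convQ a (k + 1)) ∧
    convQ a k ≤ convQ a (k + 1) ∧
    (convP a (k + 1) * convQ a k - convP a k * convQ a (k + 1)) ^ 2 = 1 := by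
  induction k with
  | zero =>
    have := ha 1 le_rfl
    simp [convP, convQ, ha0]
    omega
  | succ k ih =>
    obtain ⟨h1, ⟨h2, h3, h4⟩, h5, h6⟩ := ih
    have hA := ha (k + 2) (by omega)
    have e1 : convP a (k + 1 + 1) = a (k + 2) * convP a (k + 1) + convP a k := rfl
    have e2 : convQ a (k + 1 + 1) = a (k + 2) * convQ a (k + 1) + convQ a k := rfl
    refine ⟨⟨h2, h3, h4⟩, ?_, ?_, ?_⟩
    · rw [e1, e2]
      refine ⟨by nlinarith, by nlinarith, by nlinarith⟩
    · rw [e2]; nlinarith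
    · rw [e1, e2, ← h6]; ring

lemma convQ_step (a : ℕ → ℤ) (ha0 : a 0 = 0) (ha : ∀ i, 1 ≤ i → 1 ≤ a i) (k : ℕ) :
    convQ a (k + 1) ≤ (a (k + 1) + 1) * convQ a k := by
  rcases k with _ | k
  · simp [convQ]
  · have := (conv_basic a ha0 ha k).2.2.1
    have e2 : convQ a (k + 1 + 1) = a (k + 2) * convQ a (k + 1) + convQ a k := rfl
    rw [e2]
    show _ ≤ (a (k + 2) + 1) * convQ a (k + 1)
    linarith

lemma convQ_block (a : ℕ → ℤ) (ha0 : a 0 = 0) (ha : ∀ i, 1 ≤ i → 1 ≤ a i) (s : ℕ) (c : ℤ)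
    (hc : 1 ≤ c) (l : ℕ) (h : ∀ i, s < i → i ≤ s + l → a i = c) :
    convQ a (s + l) ≤ (c + 1) ^ l * convQ a s := by
  induction l with
  | zero => simp
  | succ l ih =>
    have h1 := ih (fun i h1 h2 => h i h1 (by omega))
    have h2 := convQ_step a ha0 ha (s + l)
    rw [h (s + l + 1) (by omega) (by omega)] at h2
    rw [← add_assoc, pow_succ']
    refine h2.trans ?_
    rw [mul_assoc]
    exact mul_le_mul_of_nonneg_left h1 (by omega)

lemma exists_block (lam : ℕ → ℕ) (hlam : ∀ n, 0 < lam n) (n i : ℕ) (hi : 1 ≤ i)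
    (hn : i ≤ ∑ k ∈ Finset.range n, lam k) :
    ∃ j < n, (∑ k ∈ Finset.range j, lam k) < i ∧ i ≤ ∑ k ∈ Finset.range (j + 1), lam k := by
  induction n with
  | zero => simp at hn; omega
  | succ n ih =>
    by_cases h : i ≤ ∑ k ∈ Finset.range n, lam k
    · obtain ⟨j, hj, h'⟩ := ih h
      exact ⟨j, by omega, h'⟩
    · exact ⟨n, by omega, by omega, hn⟩

lemma height_bound (b lam : ℕ → ℕ) (hb : ∀ n, 0 < b n) (hlam : ∀ n, 0 < lam n)
    (n : ℕ) (a : ℕ → ℤ) (ha0 : a 0 = 0)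
    (hblock : ∀ j i : ℕ, j ≤ n → (∑ k ∈ Finset.range j, lam k) < i →
      i ≤ ∑ k ∈ Finset.range (j + 1), lam k → a i = (b j : ℤ))
    (htail : ∀ i, (∑ k ∈ Finset.range (n + 1), lam k) < i → a i = (b (n + 1) : ℤ))
    (x : ℝ) (hx : IsCFValue a x) :
    (algHeight x : ℤ) ≤
      6 * (b (n + 1) : ℤ) * (∏ k ∈ Finset.range (n + 1), ((b k : ℤ) + 1) ^ lam k) ^ 2 := by
  have ha : ∀ i, 1 ≤ i → 1 ≤ a i := by
    intro i hi
    by_cases h : i ≤ ∑ k ∈ Finset.range (n + 1), lam k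
    · obtain ⟨j, hj, h1, h2⟩ := exists_block lam hlam (n + 1) i hi h
      rw [hblock j i (by omega) h1 h2]
      exact_mod_cast hb j
    · rw [htail i (by omega)]
      exact_mod_cast hb (n + 1)
  have hQ : ∀ j, j ≤ n + 1 → convQ a (∑ k ∈ Finset.range j, lam k)
      ≤ ∏ k ∈ Finset.range j, ((b k : ℤ) + 1) ^ lam k := by
    intro j
    induction j with
    | zero => simp [convQ]
    | succ j ih =>
      intro hj
      rw [Finset.prod_range_succ, mul_comm, Finset.sum_range_succ]
      refine (convQ_block a ha0 ha _ (b j) (by exact_mod_cast hb j) (lam j) ?_).trans ?_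
      · intro i h1 h2
        exact hblock j i (by omega) h1 (by rw [Finset.sum_range_succ]; exact h2)
      · exact mul_le_mul_of_nonneg_left (ih (by omega)) (by positivity)
  have hS : 1 ≤ ∑ k ∈ Finset.range (n + 1), lam k := by
    rw [Finset.sum_range_succ]
    have := hlam n
    omega
  obtain ⟨M, hM⟩ : ∃ M, ∑ k ∈ Finset.range (n + 1), lam k = M + 1 := ⟨_, (Nat.sub_add_cancel hS).symm⟩
  have hQn := hQ (n + 1) le_rfl
  rw [hM] at hQn htail
  obtain ⟨⟨h1, h2, h3⟩, ⟨h4, h5, h6⟩, h7, h8⟩ := conv_basic a ha0 ha M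
  have hB : (1 : ℤ) ≤ b (n + 1) := by exact_mod_cast hb (n + 1)
  have := algHeight_le_of_recurrence (fun k => convP a (M + k)) (fun k => convQ a (M + k))
    (b (n + 1)) hB x
    (fun k => by
      show a (M + k + 2) * convP a (M + k + 1) + convP a (M + k) = _
      rw [htail (M + k + 2) (by omega)]; rfl)
    (fun k => by
      show a (M + k + 2) * convQ a (M + k + 1) + convQ a (M + k) = _
      rw [htail (M + k + 2) (by omega)]; rfl)
    h3 h6
    (by
      have := hx.comp (tendsto_add_atTop_nat M)
      refine this.congr (fun k => ?_)
      simp [add_comm])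
    h8 h1 h4 h2 h5 h7
  refine this.trans ?_
  apply mul_le_mul_of_nonneg_left _ (by positivity)
  exact pow_le_pow_left₀ (by show 0 ≤ convQ a (M + 1); omega) hQn 2

lemma log_sum_bound (b lam : ℕ → ℕ) (hb : ∀ n, 0 < b n) (hbtop : Tendsto b atTop atTop) :
    ∃ C : ℝ, ∀ n, ∑ k ∈ Finset.range n, (lam k : ℝ) * Real.log ((b k : ℝ) + 1) ≤
      C + 2 * ∑ k ∈ Finset.range n, (lam k : ℝ) * Real.log (b k) := by
  obtain ⟨N, hN⟩ := eventually_atTop.mp (hbtop.eventually_ge_atTop 2)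
  have hnn : ∀ k, 0 ≤ (lam k : ℝ) * Real.log ((b k : ℝ) + 1) := fun k =>
    mul_nonneg (by positivity) (Real.log_nonneg (by linarith [(b k).cast_nonneg (α := ℝ)]))
  have hnn' : ∀ k, 0 ≤ (lam k : ℝ) * Real.log (b k : ℝ) := fun k =>
    mul_nonneg (by positivity) (Real.log_natCast_nonneg _)
  refine ⟨∑ k ∈ Finset.range N, (lam k : ℝ) * Real.log ((b k : ℝ) + 1), fun n => ?_⟩
  have hlarge : ∀ k, N ≤ k → (lam k : ℝ) * Real.log ((b k : ℝ) + 1)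
      ≤ 2 * ((lam k : ℝ) * Real.log (b k)) := by
    intro k hk
    have h2 : (2 : ℝ) ≤ b k := by exact_mod_cast hN k hk
    have : Real.log ((b k : ℝ) + 1) ≤ 2 * Real.log (b k) := by
      have e : 2 * Real.log (b k) = Real.log ((b k : ℝ) ^ 2) := by rw [Real.log_pow]; norm_num
      rw [e]
      exact Real.log_le_log (by linarith) (by nlinarith)
    nlinarith [(lam k).cast_nonneg (α := ℝ)]
  induction n with
  | zero => simpa using Finset.sum_nonneg fun k _ => hnn k
  | succ n ih =>
    by_cases h : N ≤ n
    · rw [Finset.sum_range_succ, Finset.sum_range_succ _ n]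
      have := hlarge n h
      linarith
    · have h1 : ∑ k ∈ Finset.range (n + 1), (lam k : ℝ) * Real.log ((b k : ℝ) + 1)
          ≤ ∑ k ∈ Finset.range N, (lam k : ℝ) * Real.log ((b k : ℝ) + 1) :=
        Finset.sum_le_sum_of_subset_of_nonneg
          (Finset.range_mono (by omega)) (fun k _ _ => hnn k)
      have h2 : 0 ≤ ∑ k ∈ Finset.range (n + 1), (lam k : ℝ) * Real.log (b k) :=
        Finset.sum_nonneg fun k _ => hnn' k
      linarith

/-- Under the growth hypotheses, with
`α n = [0; b 0 ^ (lam 0), …, b n ^ (lam n), overline{b (n+1)}]`, for all sufficiently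
large `n` one has `log H(α n) ≤ 3 * log (b (n+1))`. -/
theorem quadratic_approx_height_upper
    (b lam : ℕ → ℕ) (hb : ∀ n, 0 < b n) (hlam : ∀ n, 0 < lam n)
    (hbtop : Filter.Tendsto b Filter.atTop Filter.atTop)
    (hlamtop : Filter.Tendsto lam Filter.atTop Filter.atTop)
    (hgrow : Filter.Tendsto (fun n => Real.log (b (n + 1)) /
        ∑ k ∈ Finset.range (n + 1), (lam k : ℝ) * Real.log (b k))
      Filter.atTop Filter.atTop)
    (a : ℕ → ℤ) (ha0 : a 0 = 0)
    (hblock : ∀ j i : ℕ, (∑ k ∈ Finset.range j, lam k) < i →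
      i ≤ ∑ k ∈ Finset.range (j + 1), lam k → a i = (b j : ℤ))
    (ξ : ℝ) (hξ : IsCFValue a ξ)
    (α : ℕ → ℝ)
    (hα : ∀ n : ℕ, IsCFValue
      (fun i => if i ≤ ∑ k ∈ Finset.range (n + 2), lam k then a i else (b (n + 1) : ℤ))
      (α n))
    : ∀ᶠ n in Filter.atTop,
        Real.log (algHeight (α n)) ≤ 3 * Real.log (b (n + 1)) := by
  obtain ⟨C, hC⟩ := log_sum_bound b lam hb hbtop
  have hlogtop : Tendsto (fun n => Real.log (b (n + 1))) atTop atTop :=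
    Real.tendsto_log_atTop.comp (tendsto_natCast_atTop_atTop.comp
      (hbtop.comp (tendsto_add_atTop_nat 1)))
  filter_upwards [hgrow.eventually_ge_atTop 4, hlogtop.eventually_ge_atTop (Real.log 6 + 2 * C)]
    with n h4 hn
  have hT : 0 ≤ ∑ k ∈ Finset.range (n + 1), (lam k : ℝ) * Real.log (b k) :=
    Finset.sum_nonneg fun k _ => mul_nonneg (by positivity) (Real.log_natCast_nonneg _)
  have hT' : 0 < ∑ k ∈ Finset.range (n + 1), (lam k : ℝ) * Real.log (b k) := by
    rcases hT.lt_or_eq with h | h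
    · exact h
    · rw [← h] at h4; norm_num at h4
  rw [le_div_iff₀ hT'] at h4
  have hCn := hC (n + 1)
  have hmono : ∀ i j : ℕ, i ≤ j → ∑ k ∈ Finset.range i, lam k ≤ ∑ k ∈ Finset.range j, lam k :=
    fun i j hij => Finset.sum_le_sum_of_subset (Finset.range_mono hij)
  have hbd := height_bound b lam hb hlam n _ (by simp [ha0])
    (by
      intro j i hj h1 h2
      have := hmono (j + 1) (n + 2) (by omega)
      rw [if_pos (by omega)]
      exact hblock j i h1 h2)
    (by
      intro i hi
      split_ifs with h
      · exact hblock (n + 1) i hi h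
      · rfl) (α n) (hα n)
  have hbpos : (0 : ℝ) < b (n + 1) := by exact_mod_cast hb (n + 1)
  have hbdR : (algHeight (α n) : ℝ) ≤ 6 * (b (n + 1) : ℝ) *
      (∏ k ∈ Finset.range (n + 1), ((b k : ℝ) + 1) ^ lam k) ^ 2 := by exact_mod_cast hbd
  have hprodpos : 0 < ∏ k ∈ Finset.range (n + 1), ((b k : ℝ) + 1) ^ lam k :=
    Finset.prod_pos fun k _ => by positivity
  have hlogprod : Real.log (∏ k ∈ Finset.range (n + 1), ((b k : ℝ) + 1) ^ lam k)
      = ∑ k ∈ Finset.range (n + 1), (lam k : ℝ) * Real.log ((b k : ℝ) + 1) := by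
    rw [Real.log_prod (fun k _ => by positivity)]
    exact Finset.sum_congr rfl fun k _ => Real.log_pow _ _
  rcases Nat.eq_zero_or_pos (algHeight (α n)) with h0 | h0
  · rw [h0]
    simpa using Real.log_natCast_nonneg (b (n + 1))
  · have hle := Real.log_le_log (by exact_mod_cast h0) hbdR
    rw [Real.log_mul (by positivity) (by positivity), Real.log_mul (by norm_num) hbpos.ne',
      Real.log_pow, hlogprod] at hle
    push_cast at hle
    linarith
end
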